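/- Let H be a complex Hilbert space, 0 < θ < 1, and let A₀, A₁ be bounded, positive, invertible operators on H that commute (A₀ A₁ = A₁ A₀). Then for every x ∈ H, ∫₀^∞ t^{−2θ−1} [ inf_{y ∈ H} ( ‖A₀(x − y)‖² + t² ‖A₁ y‖² ) ] dt = (π / (2 sin(πθ))) · ‖A₀^{1−θ} A₁^{θ} x‖², where A₀^{1−θ} and A₁^{θ} denote the fractional powers of the positive operators A₀ and A₁ given by the continuous functional calculus. -/

import Mathlib

open scoped InnerProductSpace
open MeasureTheory Set

/-- The value of the normalising constant in the integral representation of `x ↦ x ^ p`. -/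
lemma Real.integral_rpowIntegrand₀₁_one {p : ℝ} (hp : p ∈ Ioo (0 : ℝ) 1) :
    ∫ t in Ioi (0 : ℝ), Real.rpowIntegrand₀₁ p t 1 = Real.pi / Real.sin (Real.pi * p) := by
  let F : ℝ → ℝ → ℝ := fun t u => t ^ (p - 1) * Real.exp (-(1 + t) * u)
  have inner_u : ∀ t ∈ Ioi (0 : ℝ), ∫ u in Ioi (0 : ℝ), F t u = Real.rpowIntegrand₀₁ p t 1 := by
    intro t ht
    have ht : 0 < t := ht
    rw [integral_const_mul, integral_exp_mul_Ioi (by linarith),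
      Real.rpowIntegrand₀₁_eq_pow_div hp ht.le zero_le_one]
    simp [div_eq_mul_inv, add_comm, -neg_add_rev]
  have hF : Integrable (Function.uncurry F)
      ((volume.restrict (Ioi (0 : ℝ))).prod (volume.restrict (Ioi (0 : ℝ)))) := by
    have hmeas : Measurable (Function.uncurry F) := by
      unfold F Function.uncurry
      fun_prop
    rw [integrable_prod_iff hmeas.aestronglyMeasurable]
    refine ⟨ae_restrict_of_forall_mem measurableSet_Ioi fun t (ht : 0 < t) => ?_, ?_⟩
    · exact (integrableOn_exp_mul_Ioi (a := -(1 + t)) (by linarith) 0).const_mul (t ^ (p - 1))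
    · refine (Real.integrableOn_rpowIntegrand₀₁_Ioi hp zero_le_one).congr_fun (fun t ht => ?_)
        measurableSet_Ioi
      have ht' : 0 < t := ht
      beta_reduce
      rw [← inner_u t ht]
      refine integral_congr_ae (.of_forall fun u => ?_)
      exact (Real.norm_of_nonneg (by simp only [F]; positivity)).symm
  have inner_t : ∀ u ∈ Ioi (0 : ℝ), ∫ t in Ioi (0 : ℝ), F t u =
      Real.Gamma p * (Real.exp (-u) * u ^ ((1 - p) - 1)) := by
    intro u hu
    have hu : 0 < u := hu
    have : ∀ t, F t u = Real.exp (-u) * (t ^ (p - 1) * Real.exp (-(u * t))) := fun t => by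
      rw [mul_left_comm, ← Real.exp_add]
      exact congrArg (fun v => t ^ (p - 1) * Real.exp v) (by ring)
    simp_rw [this]
    rw [integral_const_mul, Real.integral_rpow_mul_exp_neg_mul_Ioi hp.1 hu, one_div,
      Real.inv_rpow hu.le, ← Real.rpow_neg hu.le]
    ring_nf
  rw [← setIntegral_congr_fun measurableSet_Ioi inner_u, integral_integral_swap hF,
    setIntegral_congr_fun measurableSet_Ioi inner_t, integral_const_mul,
    ← Real.Gamma_eq_integral (by linarith [hp.2]), Real.Gamma_mul_Gamma_one_sub]

section

variable {H : Type*} [NormedAddCommGroup H] [InnerProductSpace ℂ H] [CompleteSpace H]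

/-- Completing the square: the quadratic functional is minimised at `z = R w`. -/
lemma iInf_norm_sq_add_mul_norm_sq {E R : H →L[ℂ] H} (hE : IsSelfAdjoint E) {c : ℝ} (hc : 0 ≤ c)
    (hR : E * E * (1 - R) = c • R) (w : H) :
    ⨅ z : H, (‖E (w - z)‖ ^ 2 + c * ‖z‖ ^ 2) = c * (⟪R w, w⟫_ℂ).re := by
  have hmin : E (E (w - R w)) = c • R w := by simpa using congr($hR w)
  have hsymm : ∀ a b : H, ⟪E a, E b⟫_ℂ = ⟪E (E a), b⟫_ℂ := fun a b =>
    ((ContinuousLinearMap.isSelfAdjoint_iff_isSymmetric.mp hE) (E a) b).symm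
  have key : ∀ z : H, ‖E (w - z)‖ ^ 2 + c * ‖z‖ ^ 2 =
      c * (⟪R w, w⟫_ℂ).re + (‖E (z - R w)‖ ^ 2 + c * ‖z - R w‖ ^ 2) := by
    intro z
    obtain ⟨h, rfl⟩ : ∃ h, z = R w + h := ⟨z - R w, by simp⟩
    have h1 : ‖E (w - (R w + h))‖ ^ 2 =
        c * (⟪R w, w - R w⟫_ℂ).re - 2 * (c * (⟪R w, h⟫_ℂ).re) + ‖E h‖ ^ 2 := by
      rw [← sub_sub, map_sub, @norm_sub_sq ℂ, hsymm, hmin, ← inner_self_eq_norm_sq (𝕜 := ℂ), hsymm,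
        hmin]
      simp [← Complex.coe_smul]
      ring
    have h2 : ‖R w + h‖ ^ 2 = ‖R w‖ ^ 2 + 2 * (⟪R w, h⟫_ℂ).re + ‖h‖ ^ 2 :=
      @norm_add_sq ℂ _ _ _ _ _ _
    have h3 : (⟪R w, w - R w⟫_ℂ).re = (⟪R w, w⟫_ℂ).re - ‖R w‖ ^ 2 := by
      rw [inner_sub_right, Complex.sub_re, ← inner_self_eq_norm_sq (𝕜 := ℂ)]
      rfl
    rw [h1, h2, h3, add_sub_cancel_left]
    ring
  simp_rw [key]
  refine le_antisymm ((ciInf_le ⟨c * (⟪R w, w⟫_ℂ).re, ?_⟩ (R w)).trans_eq (by simp))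
    (le_ciInf fun z => ?_)
  · rintro _ ⟨z, rfl⟩
    exact le_add_of_nonneg_right (by positivity)
  · exact le_add_of_nonneg_right (by positivity)

lemma CFC.rpow_eq_exp_smul_log {A : H →L[ℂ] H} (hA : IsStrictlyPositive A) (s : ℝ) :
    CFC.rpow A s = NormedSpace.exp (s • CFC.log A) := by
  have hspec : ∀ x ∈ spectrum ℝ A, 0 < x := fun x hx => hA.spectrum_pos hx
  have hlog : ContinuousOn Real.log (spectrum ℝ A) :=
    Real.continuousOn_log.mono fun x hx => (hspec x hx).ne'
  rw [CFC.rpow_eq_pow, CFC.rpow_eq_cfc_real hA.nonneg, CFC.log, ← cfc_smul s Real.log A,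
    ← CFC.real_exp_eq_normedSpace_exp (cfc_predicate _ _), ← cfc_comp' Real.exp _ A]
  refine cfc_congr fun x hx => ?_
  simp [Real.rpow_def_of_pos (hspec x hx), mul_comm]

lemma cfc_exp_mul {L : H →L[ℂ] H} (hL : IsSelfAdjoint L) (s : ℝ) :
    cfc (fun z : ℝ => Real.exp (s * z)) L = NormedSpace.exp (s • L) := by
  rw [← CFC.real_exp_eq_normedSpace_exp (IsSelfAdjoint.smul (.all s) hL),
    ← cfc_comp_smul s Real.exp L]
  rfl

lemma setIntegral_inner_cfc_rpowIntegrand₀₁ {p : ℝ} (hp : p ∈ Ioo (0 : ℝ) 1) {L : H →L[ℂ] H}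
    (hL : IsSelfAdjoint L) (w : H) :
    ∫ s in Ioi (0 : ℝ),
        (⟪cfc (fun z : ℝ => Real.rpowIntegrand₀₁ p s (Real.exp (2 * z))) L w, w⟫_ℂ).re =
      Real.pi / Real.sin (Real.pi * p) * ‖NormedSpace.exp (p • L) w‖ ^ 2 := by
  obtain ⟨M, hM⟩ := (spectrum.isCompact (𝕜 := ℝ) L).bddAbove
  let f : ℝ → ℝ → ℝ := fun s z => Real.rpowIntegrand₀₁ p s (Real.exp (2 * z))
  let bound : ℝ → ℝ := fun s => Real.rpowIntegrand₀₁ p s (Real.exp (2 * M))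
  have hf : ContinuousOn (Function.uncurry f) (Ioi 0 ×ˢ spectrum ℝ L) :=
    (Real.continuousOn_rpowIntegrand₀₁_uncurry hp (Ici 0) subset_rfl).comp
      (f := fun q : ℝ × ℝ => (q.1, Real.exp (2 * q.2))) (by fun_prop)
      fun q hq => ⟨hq.1, (Real.exp_pos _).le⟩
  have hbound : ∀ᵐ s ∂volume.restrict (Ioi (0 : ℝ)), ∀ z ∈ spectrum ℝ L, ‖f s z‖ ≤ bound s := by
    refine ae_restrict_of_forall_mem measurableSet_Ioi fun s (hs : 0 < s) z hz => ?_
    rw [Real.norm_of_nonneg (Real.rpowIntegrand₀₁_nonneg hp.1 hs.le (Real.exp_pos _).le)]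
    refine Real.rpowIntegrand₀₁_monotoneOn hp hs.le (Real.exp_pos _).le (Real.exp_pos _).le ?_
    have := hM hz
    gcongr
  have hfin : HasFiniteIntegral bound (volume.restrict (Ioi 0)) :=
    (Real.integrableOn_rpowIntegrand₀₁_Ioi hp (Real.exp_pos _).le).2
  have hint := integrableOn_cfc measurableSet_Ioi f bound L hf hbound hfin hL
  have hcalc := cfc_setIntegral measurableSet_Ioi f bound L hf hbound hfin hL
  have hscalar : (fun z => ∫ s in Ioi (0 : ℝ), f s z) = fun z =>
      (Real.pi / Real.sin (Real.pi * p)) • (Real.exp (p * z) * Real.exp (p * z)) := by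
    ext z
    rw [Real.integral_rpowIntegrand₀₁_eq_rpow_mul_const hp (Real.exp_pos _).le,
      Real.integral_rpowIntegrand₀₁_one hp, ← Real.exp_mul, ← Real.exp_add, smul_eq_mul, mul_comm]
    ring_nf
  rw [hscalar, cfc_smul _ _ L, cfc_mul _ _ L, cfc_exp_mul hL] at hcalc
  have hG : IsSelfAdjoint (NormedSpace.exp (p • L)) := by
    rw [← cfc_exp_mul hL]
    exact cfc_predicate _ _
  let φ : (H →L[ℂ] H) →L[ℝ] ℝ :=
    Complex.reCLM ∘L ((innerSL ℂ w).restrictScalars ℝ) ∘L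
      ((ContinuousLinearMap.apply ℂ H w).restrictScalars ℝ)
  have hφ : ∀ T, φ T = (⟪T w, w⟫_ℂ).re := fun T => by
    rw [← inner_conj_symm, Complex.conj_re]
    rfl
  simp_rw [← hφ]
  rw [φ.integral_comp_comm hint, ← hcalc, map_smul, hφ, smul_eq_mul]
  congr 1
  rw [← inner_self_eq_norm_sq (𝕜 := ℂ)]
  exact congrArg Complex.re ((ContinuousLinearMap.isSelfAdjoint_iff_isSymmetric.mp hG) _ w)

/-- The interpolation formula for the pair of norms `‖exp L ·‖` and `‖·‖`. -/
lemma setIntegral_rpow_mul_iInf_exp {θ : ℝ} (hθ : θ ∈ Ioo (0 : ℝ) 1) {L : H →L[ℂ] H}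
    (hL : IsSelfAdjoint L) (w : H) :
    ∫ t in Ioi (0 : ℝ),
        t ^ (-2 * θ - 1) * ⨅ z : H, (‖NormedSpace.exp L (w - z)‖ ^ 2 + t ^ 2 * ‖z‖ ^ 2)
      = Real.pi / (2 * Real.sin (Real.pi * θ)) * ‖NormedSpace.exp ((1 - θ) • L) w‖ ^ 2 := by
  have hp : 1 - θ ∈ Ioo (0 : ℝ) 1 := ⟨by linarith [hθ.2], by linarith [hθ.1]⟩
  have hsin : Real.sin (Real.pi * (1 - θ)) = Real.sin (Real.pi * θ) := by
    rw [mul_sub, mul_one, Real.sin_pi_sub]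
  have main := setIntegral_inner_cfc_rpowIntegrand₀₁ hp hL w
  rw [← integral_comp_rpow_Ioi_of_pos two_pos, hsin] at main
  have hE : NormedSpace.exp L = cfc (fun z : ℝ => Real.exp z) L :=
    (CFC.real_exp_eq_normedSpace_exp hL).symm
  have hEsa : IsSelfAdjoint (NormedSpace.exp L) := hE ▸ cfc_predicate _ _
  have hpt : ∀ t ∈ Ioi (0 : ℝ),
      t ^ (-2 * θ - 1) * ⨅ z : H, (‖NormedSpace.exp L (w - z)‖ ^ 2 + t ^ 2 * ‖z‖ ^ 2) =
      2⁻¹ * ((2 * t ^ ((2 : ℝ) - 1)) • (⟪cfc (fun z : ℝ =>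
        Real.rpowIntegrand₀₁ (1 - θ) (t ^ (2 : ℝ)) (Real.exp (2 * z))) L w, w⟫_ℂ).re) := by
    intro t ht
    have ht : 0 < t := ht
    let f : ℝ → ℝ := fun z => Real.exp (2 * z) / (t ^ 2 + Real.exp (2 * z))
    have hf : ContinuousOn f (spectrum ℝ L) :=
      (Continuous.div (by fun_prop) (by fun_prop) fun z => by positivity).continuousOn
    have hR : NormedSpace.exp L * NormedSpace.exp L * (1 - cfc f L) = t ^ 2 • cfc f L := by
      rw [hE, ← cfc_mul _ _ L, ← cfc_const_one ℝ L, ← cfc_sub _ _ L,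
        ← cfc_mul _ _ L (by fun_prop) (by fun_prop), ← cfc_smul _ _ L]
      refine cfc_congr fun z _ => ?_
      have : t ^ 2 + Real.exp (2 * z) ≠ 0 := by positivity
      simp only [f, smul_eq_mul, ← Real.exp_add, ← two_mul]
      field_simp
      ring
    have hcfc : cfc (fun z : ℝ =>
        Real.rpowIntegrand₀₁ (1 - θ) (t ^ (2 : ℝ)) (Real.exp (2 * z))) L =
        (t ^ (-2 * θ)) • cfc f L := by
      rw [← cfc_smul _ _ L]
      refine cfc_congr fun z _ => ?_
      rw [Real.rpowIntegrand₀₁_eq_pow_div hp (by positivity) (Real.exp_pos _).le,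
        ← Real.rpow_mul ht.le, Real.rpow_two, mul_div_assoc, smul_eq_mul]
      simp only [f]
      ring_nf
    have hpow : t ^ (-2 * θ - 1) * t ^ 2 = t * t ^ (-2 * θ) := by
      rw [Real.rpow_sub_one ht.ne']
      field_simp
    rw [iInf_norm_sq_add_mul_norm_sq hEsa (sq_nonneg t) hR, hcfc, ← mul_assoc, hpow]
    generalize cfc f L = R
    have hre : (⟪(t ^ (-2 * θ) • R) w, w⟫_ℂ).re = t ^ (-2 * θ) * (⟪R w, w⟫_ℂ).re := by
      simp [← Complex.coe_smul, mul_comm]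
    rw [hre, smul_eq_mul, sub_eq_iff_eq_add.mpr one_add_one_eq_two.symm, Real.rpow_one]
    ring
  rw [setIntegral_congr_fun measurableSet_Ioi hpt, integral_const_mul, main]
  ring

end

/-- For commuting bounded positive invertible operators `A₀, A₁` on a complex Hilbert space
`H`, `0 < θ < 1` and `x ∈ H`:
`∫₀^∞ t^{-2θ-1} inf_y (‖A₀(x - y)‖² + t²‖A₁ y‖²) dt = (π / (2 sin πθ)) ‖A₀^{1-θ} A₁^θ x‖²`,
where the fractional powers are given by the continuous functional calculus. -/
theorem stmt_8 {H : Type*} [NormedAddCommGroup H] [InnerProductSpace ℂ H] [CompleteSpace H]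
    (θ : ℝ) (hθ : θ ∈ Set.Ioo (0 : ℝ) 1)
    (A₀ A₁ : H →L[ℂ] H) (hA₀ : A₀.IsPositive) (hA₁ : A₁.IsPositive)
    (hA₀inv : IsUnit A₀) (hA₁inv : IsUnit A₁)
    (hcomm : A₀ * A₁ = A₁ * A₀) (x : H) :
    ∫ t in Set.Ioi (0 : ℝ),
        t ^ (-2 * θ - 1) * ⨅ y : H, (‖A₀ (x - y)‖ ^ 2 + t ^ 2 * ‖A₁ y‖ ^ 2)
      = Real.pi / (2 * Real.sin (Real.pi * θ)) *
          ‖(CFC.rpow A₀ (1 - θ)) ((CFC.rpow A₁ θ) x)‖ ^ 2 := by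
  have h₀ := hA₀inv.isStrictlyPositive (A₀.nonneg_iff_isPositive.mpr hA₀)
  have h₁ := hA₁inv.isStrictlyPositive (A₁.nonneg_iff_isPositive.mpr hA₁)
  let +nondep : NormedAlgebra ℚ (H →L[ℂ] H) := .restrictScalars ℚ ℂ _
  have hlog : Commute (CFC.log A₀) (CFC.log A₁) :=
    Commute.cfc_real (Commute.cfc_real (Commute.symm hcomm) _).symm _
  set L := CFC.log A₀ - CFC.log A₁ with hLdef
  have hL : IsSelfAdjoint L := IsSelfAdjoint.log.sub IsSelfAdjoint.log
  have hLlog : Commute L (CFC.log A₁) := hlog.sub_left (.refl _)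
  have hA₀eq : A₀ = NormedSpace.exp L * A₁ := by
    conv_rhs => rw [← CFC.exp_log A₁ h₁]
    rw [← NormedSpace.exp_add_of_commute hLlog, sub_add_cancel, CFC.exp_log A₀ h₀]
  have hpow : CFC.rpow A₀ (1 - θ) * CFC.rpow A₁ θ = NormedSpace.exp ((1 - θ) • L) * A₁ := by
    conv_rhs => rw [← CFC.exp_log A₁ h₁]
    rw [CFC.rpow_eq_exp_smul_log h₀, CFC.rpow_eq_exp_smul_log h₁,
      ← NormedSpace.exp_add_of_commute ((hlog.smul_left _).smul_right _),
      ← NormedSpace.exp_add_of_commute (hLlog.smul_left _), hLdef]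
    congr 1
    module
  have hsurj : Function.Surjective A₁ := fun z => by
    obtain ⟨u, rfl⟩ := hA₁inv
    exact ⟨(↑u⁻¹ : H →L[ℂ] H) z, congr($(u.mul_inv) z)⟩
  rw [← mul_apply_eq_comp, hpow, mul_apply_eq_comp,
    ← setIntegral_rpow_mul_iInf_exp hθ hL (A₁ x)]
  have hsub : ∀ y, A₀ (x - y) = NormedSpace.exp L (A₁ x - A₁ y) := fun y => by
    rw [← map_sub, ← mul_apply_eq_comp, ← hA₀eq]
  simp_rw [hsub]
  congr 1 with t
  congr 1
  exact hsurj.iInf_comp fun z => ‖NormedSpace.exp L (A₁ x - z)‖ ^ 2 + t ^ 2 * ‖z‖ ^ 2
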